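/- For any integers i, j with 1 ≤ i ≤ j ≤ n, we have [t_i, t_j]^{j−i+1} = 0 in k[S_n]. -/

import Mathlib

/-- The simple transposition `s_i ∈ S_n` (1-based indexing), swapping `i` and `i+1`,
defined as the identity for `i` outside `{1, …, n-1}`. -/
def simpleTransposition (n i : ℕ) : Equiv.Perm (Fin n) :=
  if h : 1 ≤ i ∧ i < n then
    Equiv.swap ⟨i - 1, by omega⟩ ⟨i, h.2⟩
  else 1

/-- The cycle `(v ⟹ w) = s_v s_{v+1} ⋯ s_{w-1} ∈ S_n`, sending
`v ↦ v+1 ↦ ⋯ ↦ w ↦ v` (and equal to the identity when `v = w`). -/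
def cyc (n v w : ℕ) : Equiv.Perm (Fin n) :=
  ((List.range' v (w - v)).map (simpleTransposition n)).prod

/-- The somewhere-to-below shuffle `t_ℓ = Σ_{w=ℓ}^{n} (ℓ ⟹ w)` in the group
algebra `R[S_n]`. -/
noncomputable def t (R : Type*) [CommRing R] (n ℓ : ℕ) :
    MonoidAlgebra R (Equiv.Perm (Fin n)) :=
  ∑ w ∈ Finset.Icc ℓ n, MonoidAlgebra.of R (Equiv.Perm (Fin n)) (cyc n ℓ w)

theorem simpleTransposition_mul_self (n i : ℕ) :
    simpleTransposition n i * simpleTransposition n i = 1 := by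
  unfold simpleTransposition
  split_ifs <;> simp

theorem simpleTransposition_commute (n : ℕ) {i j : ℕ} (h : i + 2 ≤ j) :
    Commute (simpleTransposition n i) (simpleTransposition n j) := by
  unfold simpleTransposition
  split_ifs with hi hj
  · refine (Equiv.Perm.disjoint_iff_disjoint_support.2 ?_).commute
    rw [Equiv.Perm.support_swap (by simp [Fin.ext_iff]; omega),
      Equiv.Perm.support_swap (by simp [Fin.ext_iff]; omega)]
    simp [Fin.ext_iff]
    omega
  all_goals simp

theorem simpleTransposition_braid (n : ℕ) {i : ℕ} (hi : 1 ≤ i) (hn : i + 1 < n) :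
    simpleTransposition n i * simpleTransposition n (i + 1) * simpleTransposition n i =
      simpleTransposition n (i + 1) * simpleTransposition n i * simpleTransposition n (i + 1) := by
  have h₁ : 1 ≤ i ∧ i < n := by omega
  have h₂ : 1 ≤ i + 1 ∧ i + 1 < n := by omega
  simp only [simpleTransposition, dif_pos h₁, dif_pos h₂, Nat.add_sub_cancel]
  have ha : (⟨i - 1, by omega⟩ : Fin n) ≠ ⟨i, h₁.2⟩ := by simp [Fin.ext_iff]; omega
  have hb : (⟨i, h₁.2⟩ : Fin n) ≠ ⟨i + 1, hn⟩ := by simp [Fin.ext_iff]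
  have hc : (⟨i - 1, by omega⟩ : Fin n) ≠ ⟨i + 1, hn⟩ := by simp [Fin.ext_iff]
  generalize (⟨i - 1, _⟩ : Fin n) = a at *
  generalize (⟨i, _⟩ : Fin n) = b at *
  generalize (⟨i + 1, _⟩ : Fin n) = c at *
  rw [Equiv.swap_mul_swap_mul_swap ha hc, Equiv.swap_comm a b, Equiv.swap_comm b c,
    Equiv.swap_mul_swap_mul_swap hb.symm hc.symm, Equiv.swap_comm]

theorem cyc_self (n v : ℕ) : cyc n v v = 1 := by simp [cyc]

theorem cyc_eq_mul (n : ℕ) {v w : ℕ} (h : v < w) :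
    cyc n v w = simpleTransposition n v * cyc n (v + 1) w := by
  obtain ⟨m, rfl⟩ := Nat.exists_eq_add_of_lt h
  simp [cyc, List.range'_succ, show v + m + 1 - v = m + 1 by omega,
    show v + m + 1 - (v + 1) = m by omega]

section GroupAlgebra

variable (R : Type*) [CommRing R] (n : ℕ)

/-- The simple transposition `s_i` as an element of the group algebra. -/
noncomputable def simpleReflection (i : ℕ) : MonoidAlgebra R (Equiv.Perm (Fin n)) :=
  MonoidAlgebra.of R (Equiv.Perm (Fin n)) (simpleTransposition n i)

local notation "σ" => simpleReflection R n
local notation "τ" => t R n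

theorem simpleReflection_mul_self (i : ℕ) : σ i * σ i = 1 := by
  rw [simpleReflection, ← map_mul, simpleTransposition_mul_self, map_one]

theorem simpleReflection_commute {i j : ℕ} (h : i + 2 ≤ j) : Commute (σ i) (σ j) :=
  (simpleTransposition_commute n h).map _

theorem simpleReflection_braid {i : ℕ} (hi : 1 ≤ i) (hn : i + 1 < n) :
    σ i * σ (i + 1) * σ i = σ (i + 1) * σ i * σ (i + 1) := by
  simp only [simpleReflection, ← map_mul, simpleTransposition_braid n hi hn]

theorem t_eq_zero {i : ℕ} (h : n < i) : τ i = 0 := by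
  rw [t, Finset.Icc_eq_empty (by omega), Finset.sum_empty]

theorem t_eq_one_add {i : ℕ} (h : i ≤ n) : τ i = 1 + σ i * τ (i + 1) := by
  rw [t, ← Finset.add_sum_Ioc_eq_sum_Icc h, cyc_self, map_one, t, Finset.mul_sum,
    ← Finset.Icc_add_one_left_eq_Ioc]
  congr 1
  refine Finset.sum_congr rfl fun w hw => ?_
  rw [Finset.mem_Icc] at hw
  rw [cyc_eq_mul n (by omega : i < w), map_mul, simpleReflection]

theorem simpleReflection_commute_t {i j : ℕ} (h : i + 2 ≤ j) : Commute (σ i) (τ j) := by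
  by_cases hj : n < j
  · rw [t_eq_zero R n hj]
    exact Commute.zero_right _
  have hj' := not_lt.1 hj
  induction hj' using Nat.decreasingInduction with
  | self =>
    rw [t_eq_one_add R n le_rfl, t_eq_zero R n (Nat.lt_succ_self n)]
    simp
  | of_succ j hjn ih =>
    rw [t_eq_one_add R n hjn.le]
    exact (Commute.one_right _).add_right
      ((simpleReflection_commute R n h).mul_right (ih (by omega) (by omega)))

theorem t_succ_mul_t {i : ℕ} (hi : 1 ≤ i) (hin : i ≤ n) :
    τ (i + 1) * τ i = (τ i - 1) * τ i := by
  induction hin using Nat.decreasingInduction with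
  | self =>
    rw [t_eq_one_add R n le_rfl, t_eq_zero R n (Nat.lt_succ_self n)]
    simp
  | of_succ i hin ih =>
    have hT := t_eq_one_add R n (i := i + 1) hin
    have hu := ih (by omega)
    have hcomm := (simpleReflection_commute_t R n (le_refl (i + 2))).eq
    have hs := simpleReflection_mul_self R n i
    rw [t_eq_one_add R n (i := i) (by omega), add_sub_cancel_left]
    rw [add_assoc, one_add_one_eq_two] at hT hu
    have hb : σ i * (σ (i + 1) * (σ i * τ (i + 2))) =
        σ (i + 1) * (σ i * (σ (i + 1) * τ (i + 2))) := by
      rcases (Nat.succ_le_of_lt hin).eq_or_lt with h | h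
      · rw [t_eq_zero R n (by omega : n < i + 2)]
        simp
      · simpa only [mul_assoc] using
          congrArg (· * τ (i + 2)) (simpleReflection_braid R n (by omega) h)
    generalize τ (i + 2) = u at *
    generalize τ (i + 1) = T at *
    generalize σ i = a at *
    generalize σ (i + 1) = b at *
    have hu' : b * (u * T) = u * T := by
      rw [← mul_assoc, show b * u = T - 1 by rw [hT, add_sub_cancel_left], hu]
    have hP : a * (b * (a * (u * T))) = b * (a * (u * T)) := by
      have h := congrArg (· * T) hb
      simpa only [mul_assoc, hu'] using h
    have hTaT : T * (a * T) = a * T + b * (a * (u * T)) := by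
      nth_rw 1 [hT]
      rw [add_mul, one_mul, ← mul_assoc (b * u), mul_assoc b, ← hcomm]
      simp only [mul_assoc]
    rw [mul_add, hTaT, mul_one, mul_add, mul_one, mul_assoc a, hTaT, mul_add, hP,
      ← mul_assoc a a, hs, one_mul]
    abel

theorem t_add_two_mul {i : ℕ} (hi : 1 ≤ i) (hin : i + 1 ≤ n) :
    τ (i + 2) * (τ i - 1) = (τ i - 1) * (τ (i + 1) - 1) := by
  have h₁ := t_succ_mul_t R n (i := i + 1) (by omega) hin
  rw [t_eq_one_add R n (i := i) (by omega), add_sub_cancel_left, ← mul_assoc,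
    ← (simpleReflection_commute_t R n le_rfl).eq, mul_assoc, h₁]
  noncomm_ring

theorem commutator_t_eq_mul {i j : ℕ} (hij : i + 2 ≤ j) (hjn : j ≤ n) :
    τ i * τ j - τ j * τ i = σ i * (τ (i + 1) * τ j - τ j * τ (i + 1)) := by
  have h := (simpleReflection_commute_t R n hij).eq
  rw [t_eq_one_add R n (i := i) (by omega), mul_sub, ← mul_assoc (σ i) (τ j), h]
  noncomm_ring

theorem simpleReflection_commute_commutator {i k j : ℕ} (hk : i + 2 ≤ k) (hj : i + 2 ≤ j) :
    Commute (σ i) (τ k * τ j - τ j * τ k) := by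
  have hk' := simpleReflection_commute_t R n hk
  have hj' := simpleReflection_commute_t R n hj
  exact (hk'.mul_right hj').sub_right (hj'.mul_right hk')

theorem sq_commutator_t_succ {i : ℕ} (hi : 1 ≤ i) (hin : i ≤ n) :
    (τ i * τ (i + 1) - τ (i + 1) * τ i) ^ 2 = 0 := by
  have h := t_succ_mul_t R n hi hin
  have hx : τ i * τ (i + 1) - τ (i + 1) * τ i = τ i * (τ (i + 1) - τ i + 1) := by
    rw [h]; noncomm_ring
  have h0 : (τ (i + 1) - τ i + 1) * τ i = 0 := by
    rw [add_mul, sub_mul, h]; noncomm_ring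
  rw [hx, sq, mul_assoc, ← mul_assoc _ (τ i), h0, zero_mul, mul_zero]

theorem sq_commutator_t_add_two {i : ℕ} (hi : 1 ≤ i) (hin : i + 1 ≤ n) :
    (τ i * τ (i + 2) - τ (i + 2) * τ i) ^ 2 =
      (τ (i + 1) * τ (i + 2) - τ (i + 2) * τ (i + 1)) *
        (τ i * τ (i + 2) - τ (i + 2) * τ i) := by
  have h₁ := t_succ_mul_t R n hi (by omega : i ≤ n)
  have h₂ := t_succ_mul_t R n (i := i + 1) (by omega) hin
  have h₃ := t_add_two_mul R n hi hin
  have hx : τ i * τ (i + 2) - τ (i + 2) * τ i = (τ i - 1) * (τ (i + 2) - τ (i + 1) + 1) := by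
    rw [show τ i * τ (i + 2) - τ (i + 2) * τ i =
      (τ i - 1) * τ (i + 2) - τ (i + 2) * (τ i - 1) by noncomm_ring, h₃]
    noncomm_ring
  have hy : τ (i + 1) * τ (i + 2) - τ (i + 2) * τ (i + 1) =
      τ (i + 1) * (τ (i + 2) - τ (i + 1) + 1) := by
    rw [show i + 2 = i + 1 + 1 from rfl, h₂]; noncomm_ring
  have hz : (τ (i + 2) - τ (i + 1) + 1) * (τ i - 1) = τ i * (τ (i + 1) - τ i + 1) := by
    rw [add_mul, sub_mul, h₃, mul_sub (τ (i + 1)), h₁]; noncomm_ring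
  rw [hx, hy, sq, mul_assoc, mul_assoc, ← mul_assoc _ (τ i - 1), hz, ← mul_assoc, ← mul_assoc,
    ← mul_assoc, ← mul_assoc, h₁]

theorem sq_commutator_t {i j : ℕ} (hi : 1 ≤ i) (hij : i < j) (hjn : j ≤ n) :
    (τ i * τ j - τ j * τ i) ^ 2 =
      (τ (i + 1) * τ j - τ j * τ (i + 1)) * (τ i * τ j - τ j * τ i) := by
  obtain rfl | hij' := (Nat.succ_le_of_lt hij).eq_or_lt
  · rw [sq_commutator_t_succ R n hi (by omega), sub_self, zero_mul]
  have hij'' : i ≤ j - 2 := by omega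
  induction hij'' using Nat.decreasingInduction with
  | self =>
    obtain ⟨k, rfl⟩ := Nat.exists_eq_add_of_le' (by omega : 2 ≤ j)
    exact sq_commutator_t_add_two R n hi (by simp at *; omega)
  | of_succ i hlt ih =>
    have hb := simpleReflection_braid R n hi (by omega : i + 1 < n)
    have e₁ := commutator_t_eq_mul R n (i := i) (j := j) (by omega) hjn
    have e₂ := commutator_t_eq_mul R n (i := i + 1) (j := j) (by omega) hjn
    have hc := (simpleReflection_commute_commutator R n (i := i) (k := i + 2) (j := j)
      le_rfl (by omega)).eq
    have h := ih (by omega) (by omega) (by omega)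
    rw [add_assoc, one_add_one_eq_two] at e₂ h
    generalize τ i * τ j - τ j * τ i = x at *
    generalize τ (i + 1) * τ j - τ j * τ (i + 1) = y at *
    generalize τ (i + 2) * τ j - τ j * τ (i + 2) = z at *
    subst e₁
    have h' : σ (i + 1) * (z * y) = z * y := by rw [← mul_assoc, ← e₂, ← sq, h]
    calc (σ i * y) ^ 2 = σ i * (σ (i + 1) * z) * (σ i * y) := by rw [← e₂, sq]
      _ = σ i * σ (i + 1) * (z * σ i) * y := by simp only [mul_assoc]
      _ = (σ i * σ (i + 1) * σ i) * (z * y) := by rw [← hc]; simp only [mul_assoc]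
      _ = σ (i + 1) * σ i * (σ (i + 1) * (z * y)) := by rw [hb]; simp only [mul_assoc]
      _ = σ (i + 1) * (σ i * z) * y := by rw [h']; simp only [mul_assoc]
      _ = y * (σ i * y) := by rw [hc, ← mul_assoc, ← e₂, mul_assoc]

end GroupAlgebra

theorem somewhere_to_below_left_bound
    (R : Type*) [CommRing R] (n : ℕ) (hn : 0 < n)
    (i j : ℕ) (hi1 : 1 ≤ i) (hij : i ≤ j) (hjn : j ≤ n) :
    (t R n i * t R n j - t R n j * t R n i) ^ (j - i + 1) = 0 := by
  induction hij using Nat.decreasingInduction with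
  | self => simp
  | of_succ i hij ih =>
    have hsq := sq_commutator_t R n hi1 hij hjn
    have h := ih (by omega)
    rw [show j - (i + 1) + 1 = j - i by omega] at h
    generalize t R n i * t R n j - t R n j * t R n i = x at *
    generalize t R n (i + 1) * t R n j - t R n j * t R n (i + 1) = y at *
    have hpow : ∀ m : ℕ, x ^ (m + 1) = y ^ m * x := by
      intro m
      induction m with
      | zero => simp
      | succ m ihm => rw [pow_succ, ihm, mul_assoc, ← sq, hsq, pow_succ, mul_assoc]
    rw [hpow, h, zero_mul]
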